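/- arXiv:1109.0306 — 2 statements merged into one kernel-verified Lean document; each statement's English description precedes it below -/
import Mathlib

section
/- Let n ≥ 1, p > 1, α > 0 and r > 0, and let w be a weight on ℂⁿ belonging to A_{p,r}. Then the operator H_α f(z) = ∫_{ℂⁿ} e^{-(α/2)|z-u|²} f(u) dv(u) is bounded on L^p(ℂⁿ, w dv): there exists a constant C > 0 such that for every measurable function f : ℂⁿ → [0,∞), ∫_{ℂⁿ} (H_α f(z))^p w(z) dv(z) ≤ C ∫_{ℂⁿ} f(z)^p w(z) dv(z). -/
open MeasureTheory ENNReal Metric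

noncomputable section

/-- We identify `ℂⁿ` with `ℝ^{2n}` equipped with Lebesgue measure. -/
abbrev En (n : ℕ) := EuclideanSpace ℂ (Fin n)

instance (n : ℕ) : MeasurableSpace (En n) := borel _
instance (n : ℕ) : BorelSpace (En n) := ⟨rfl⟩
instance (n : ℕ) : InnerProductSpace ℝ (En n) := InnerProductSpace.complexToReal

/-- The axis-parallel cube with center `z` and side length `r`. -/
def cube (n : ℕ) (r : ℝ) (z : En n) : Set (En n) :=
  {u | ∀ j, |(u j).re - (z j).re| ≤ r / 2 ∧ |(u j).im - (z j).im| ≤ r / 2}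

/-- A weight on `ℂⁿ`: measurable, positive a.e. and locally integrable. -/
def IsWeight (n : ℕ) (w : En n → ℝ) : Prop :=
  Measurable w ∧ (∀ᵐ z : En n, 0 < w z) ∧ LocallyIntegrable w volume

/-- The restricted Muckenhoupt condition `A_{p,r}`. -/
def MemApr (n : ℕ) (p r : ℝ) (w : En n → ℝ) : Prop :=
  ∃ C : ℝ, ∀ z : En n,
    ((volume (cube n r z))⁻¹ * ∫⁻ u in cube n r z, ENNReal.ofReal (w u)) *
      ((volume (cube n r z))⁻¹ *
        ∫⁻ u in cube n r z, ENNReal.ofReal (w u ^ (-(1 / (p - 1))))) ^ (p - 1)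
      ≤ ENNReal.ofReal C

/-- Hölder's inequality with respect to a weight `ω` and its dual weight `σ`. -/
theorem lintegral_rpow_le_of_dual_weight {X : Type*} [MeasurableSpace X] {μ : Measure X} {p : ℝ}
    (hp : 1 < p) {g ω σ : X → ℝ≥0∞} (hg : AEMeasurable g μ) (hω : AEMeasurable ω μ)
    (hσ : AEMeasurable σ μ) (hdual : ∀ᵐ x ∂μ, ω x * σ x ^ (p - 1) = 1) :
    (∫⁻ x, g x ∂μ) ^ p ≤ (∫⁻ x, g x ^ p * ω x ∂μ) * (∫⁻ x, σ x ∂μ) ^ (p - 1) := by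
  have hp0 : 0 < p := by linarith
  have hp1 : 0 < p - 1 := by linarith
  have hpq : p.HolderConjugate (p / (p - 1)) := Real.HolderConjugate.conjExponent hp
  have hH := ENNReal.lintegral_mul_le_Lp_mul_Lq μ hpq
    (f := fun x => g x * ω x ^ (1 / p)) (g := fun x => σ x ^ ((p - 1) / p))
    (hg.mul (hω.pow_const _)) (hσ.pow_const _)
  have h1 : ∫⁻ x, g x ∂μ =
      ∫⁻ x, ((fun x => g x * ω x ^ (1 / p)) * fun x => σ x ^ ((p - 1) / p)) x ∂μ := by
    refine lintegral_congr_ae ?_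
    filter_upwards [hdual] with x hx
    have : ω x ^ (1 / p) * σ x ^ ((p - 1) / p) = 1 := by
      rw [show (p - 1) / p = (p - 1) * (1 / p) by ring, ENNReal.rpow_mul,
        ← ENNReal.mul_rpow_of_nonneg _ _ (by positivity), hx, ENNReal.one_rpow]
    simp only [Pi.mul_apply]
    rw [mul_assoc, this, mul_one]
  have h2 : ∀ x, (g x * ω x ^ (1 / p)) ^ p = g x ^ p * ω x := fun x => by
    rw [ENNReal.mul_rpow_of_nonneg _ _ hp0.le, ← ENNReal.rpow_mul, one_div_mul_cancel hp0.ne',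
      ENNReal.rpow_one]
  have h3 : ∀ x, (σ x ^ ((p - 1) / p)) ^ (p / (p - 1)) = σ x := fun x => by
    rw [← ENNReal.rpow_mul, div_mul_div_cancel₀ hp0.ne', div_self hp1.ne', ENNReal.rpow_one]
  simp only [h2, h3] at hH
  rw [← h1] at hH
  refine (ENNReal.rpow_le_rpow hH hp0.le).trans_eq ?_
  rw [ENNReal.mul_rpow_of_nonneg _ _ hp0.le, ← ENNReal.rpow_mul, ← ENNReal.rpow_mul,
    one_div_mul_cancel hp0.ne', ENNReal.rpow_one, one_div_div, div_mul_cancel₀ _ hp0.ne']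

/-- Jensen's inequality for integration against a positive finite kernel. -/
theorem lintegral_mul_rpow_le {X : Type*} [MeasurableSpace X] {μ : Measure X} {p : ℝ}
    (hp : 1 < p) {k g : X → ℝ≥0∞} (hk : Measurable k) (hg : Measurable g)
    (hk0 : ∀ x, k x ≠ 0) (hkt : ∀ x, k x ≠ ∞) :
    (∫⁻ x, k x * g x ∂μ) ^ p ≤ (∫⁻ x, k x * g x ^ p ∂μ) * (∫⁻ x, k x ∂μ) ^ (p - 1) := by
  have hp0 : 0 < p := by linarith
  have hH := lintegral_rpow_le_of_dual_weight (μ := μ) hp (g := fun x => k x * g x)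
    (ω := fun x => k x ^ (1 - p)) (σ := k) (hk.mul hg).aemeasurable
    (hk.pow_const _).aemeasurable hk.aemeasurable (ae_of_all _ fun x => by
      rw [← ENNReal.rpow_add _ _ (hk0 x) (hkt x)]; simp)
  refine hH.trans_eq ?_
  congr 1
  refine lintegral_congr fun x => ?_
  rw [ENNReal.mul_rpow_of_nonneg _ _ hp0.le, mul_right_comm,
    ← ENNReal.rpow_add _ _ (hk0 x) (hkt x)]
  simp

section Gaussian

variable {V : Type*} [NormedAddCommGroup V]

/-- The Gaussian `exp (-a‖x‖²)` as an extended nonnegative function. -/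
def gaussianKernel (a : ℝ) (x : V) : ℝ≥0∞ := ENNReal.ofReal (Real.exp (-a * ‖x‖ ^ 2))

theorem gaussianKernel_ne_zero (a : ℝ) (x : V) : gaussianKernel a x ≠ 0 := by
  simp [gaussianKernel, Real.exp_pos]

theorem gaussianKernel_ne_top (a : ℝ) (x : V) : gaussianKernel a x ≠ ∞ := ENNReal.ofReal_ne_top

theorem gaussianKernel_neg (a : ℝ) (x : V) : gaussianKernel a (-x) = gaussianKernel a x := by
  simp [gaussianKernel]

@[fun_prop]
theorem measurable_gaussianKernel [MeasurableSpace V] [BorelSpace V] (a : ℝ) :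
    Measurable (gaussianKernel a : V → ℝ≥0∞) := by
  unfold gaussianKernel
  fun_prop

theorem gaussianKernel_le_of_norm_sub_le {a R : ℝ} (ha : 0 ≤ a) {x y : V} (h : ‖x - y‖ ≤ R) :
    gaussianKernel a x ≤ ENNReal.ofReal (Real.exp (a * R ^ 2)) * gaussianKernel (a / 2) y := by
  unfold gaussianKernel
  rw [← ENNReal.ofReal_mul (Real.exp_pos _).le, ← Real.exp_add]
  refine ENNReal.ofReal_le_ofReal (Real.exp_le_exp.2 ?_)
  have hR : 0 ≤ R := (norm_nonneg _).trans h
  have h1 : ‖y‖ ≤ ‖x‖ + R := by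
    have := norm_sub_le x (x - y)
    rw [sub_sub_self] at this
    linarith
  have h2 : ‖y‖ ^ 2 ≤ 2 * ‖x‖ ^ 2 + 2 * R ^ 2 := by
    nlinarith [sq_nonneg (‖x‖ - R), norm_nonneg y, norm_nonneg x]
  nlinarith

/-- A Gaussian absorbs exponential growth. -/
theorem exists_gaussianKernel_mul_pow_le {b ρ : ℝ} (hb : 0 < b) (hρ : 0 < ρ) {D : ℝ≥0∞}
    (hD : D ≠ ∞) : ∃ c : ℝ≥0∞, c ≠ ∞ ∧ ∀ x : V,
      gaussianKernel b x * D ^ ⌈‖x‖ / ρ⌉₊ ≤ c * gaussianKernel (b / 2) x := by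
  obtain ⟨L, hL0, hL⟩ : ∃ L : ℝ, 0 ≤ L ∧ D ≤ ENNReal.ofReal (Real.exp L) := by
    refine ⟨D.toReal, ENNReal.toReal_nonneg, ?_⟩
    conv_lhs => rw [← ENNReal.ofReal_toReal hD]
    exact ENNReal.ofReal_le_ofReal (by linarith [Real.add_one_le_exp D.toReal])
  refine ⟨ENNReal.ofReal (Real.exp (L + (L / ρ) ^ 2 / (2 * b))), ENNReal.ofReal_ne_top,
    fun x => ?_⟩
  have hceil : (⌈‖x‖ / ρ⌉₊ : ℝ) ≤ ‖x‖ / ρ + 1 := (Nat.ceil_lt_add_one (by positivity)).le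
  refine (mul_le_mul_right (pow_le_pow_left' hL _) _).trans ?_
  unfold gaussianKernel
  rw [← ENNReal.ofReal_pow (Real.exp_pos _).le, ← Real.exp_nat_mul,
    ← ENNReal.ofReal_mul (Real.exp_pos _).le, ← ENNReal.ofReal_mul (Real.exp_pos _).le,
    ← Real.exp_add, ← Real.exp_add]
  refine ENNReal.ofReal_le_ofReal (Real.exp_le_exp.2 ?_)
  have h1 : (⌈‖x‖ / ρ⌉₊ : ℝ) * L ≤ (‖x‖ / ρ + 1) * L := mul_le_mul_of_nonneg_right hceil hL0
  have h2 : 0 ≤ b / 2 * (‖x‖ - L / ρ / b) ^ 2 := by positivity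
  have h3 : b / 2 * (‖x‖ - L / ρ / b) ^ 2
      = b / 2 * ‖x‖ ^ 2 - ‖x‖ / ρ * L + (L / ρ) ^ 2 / (2 * b) := by
    field_simp
    ring
  linarith

theorem lintegral_gaussianKernel_ne_top [InnerProductSpace ℝ V] [FiniteDimensional ℝ V]
    [MeasurableSpace V] [BorelSpace V] {a : ℝ} (ha : 0 < a) :
    ∫⁻ x : V, gaussianKernel a x ≠ ∞ := by
  have h := GaussianFourier.integrable_cexp_neg_mul_sq_norm_add (b := (a : ℂ)) (by simpa using ha)
    0 (0 : V)
  have h2 := h.norm.lintegral_lt_top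
  refine (lt_of_eq_of_lt (lintegral_congr fun x => ?_) h2).ne
  simp only [gaussianKernel, Complex.norm_exp]
  congr 3
  norm_cast
  simp

end Gaussian

/-- Iterating a local comparison along a segment gives exponential growth. -/
theorem le_pow_ceil_mul_of_local_le {V : Type*} [NormedAddCommGroup V]
    [NormedSpace ℝ V] {ρ : ℝ} (hρ : 0 < ρ) {D : ℝ≥0∞}
    {W : V → ℝ≥0∞} (hW : ∀ z z', ‖z - z'‖ ≤ ρ → W z ≤ D * W z') (y v : V) :
    W y ≤ D ^ ⌈‖y - v‖ / ρ⌉₊ * W v := by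
  suffices h : ∀ (m : ℕ) (y v : V), ‖y - v‖ ≤ m * ρ → W y ≤ D ^ m * W v from
    h _ y v ((div_le_iff₀ hρ).1 (Nat.le_ceil _))
  intro m
  induction m with
  | zero =>
    intro y v h
    have : y = v := by simpa [sub_eq_zero] using h
    simp [this]
  | succ m ih =>
    intro y v h
    push_cast at h
    have hm : (0 : ℝ) < m + 1 := by positivity
    set x : V := v + ((m : ℝ) / (m + 1)) • (y - v) with hx
    have h1 : ‖y - x‖ ≤ ρ := by
      have : y - x = (1 / ((m : ℝ) + 1)) • (y - v) := by
        have h3 : (m : ℝ) / (m + 1) = 1 - 1 / ((m : ℝ) + 1) := by field_simp; ring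
        rw [hx, h3, sub_smul, one_smul]
        abel
      rw [this, norm_smul, Real.norm_of_nonneg (by positivity), one_div_mul_eq_div,
        div_le_iff₀ hm]
      linarith
    have h2 : ‖x - v‖ ≤ m * ρ := by
      rw [hx, add_sub_cancel_left, norm_smul, Real.norm_of_nonneg (by positivity),
        div_mul_eq_mul_div, div_le_iff₀ hm]
      nlinarith [(Nat.cast_nonneg m : (0 : ℝ) ≤ m)]
    calc W y ≤ D * W x := hW _ _ h1
      _ ≤ D * (D ^ m * W v) := by gcongr; exact ih _ _ h2
      _ = D ^ (m + 1) * W v := by ring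

section Weights

variable {V : Type*} [NormedAddCommGroup V] [MeasurableSpace V] [BorelSpace V]

/-- The integral of `g` over the translate of `Q` by `v`. -/
def translateIntegral (μ : Measure V) (Q : Set V) (g : V → ℝ≥0∞) (v : V) : ℝ≥0∞ :=
  ∫⁻ u, Q.indicator 1 (u - v) * g u ∂μ

variable {μ : Measure V} {Q : Set V}

theorem measurable_translateIntegral [SecondCountableTopology V] [SFinite μ]
    (hQ : MeasurableSet Q) {g : V → ℝ≥0∞}
    (hg : Measurable g) : Measurable (translateIntegral μ Q g) := by
  have h1 : Measurable (Q.indicator (1 : V → ℝ≥0∞)) := measurable_one.indicator hQ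
  refine Measurable.lintegral_prod_right' (f := fun q : V × V =>
    Q.indicator (1 : V → ℝ≥0∞) (q.2 - q.1) * g q.2) ?_
  exact (h1.comp (measurable_snd.sub measurable_fst)).mul (hg.comp measurable_snd)

theorem translateIntegral_eq_setLIntegral (hQ : MeasurableSet Q) (g : V → ℝ≥0∞) (v : V) :
    translateIntegral μ Q g v = ∫⁻ u in {u | u - v ∈ Q}, g u ∂μ := by
  have hm : MeasurableSet {u | u - v ∈ Q} := hQ.preimage (by fun_prop)
  rw [← lintegral_indicator hm]
  refine lintegral_congr fun u => ?_
  by_cases h : u - v ∈ Q <;> simp [h]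

theorem lintegral_indicator_sub_left [μ.IsAddHaarMeasure] [μ.IsNegInvariant]
    (hQ : MeasurableSet Q) (u : V) :
    ∫⁻ v, Q.indicator 1 (u - v) ∂μ = μ Q := by
  rw [lintegral_sub_left_eq_self (fun x => Q.indicator (1 : V → ℝ≥0∞) x) u,
    lintegral_indicator_one hQ]

theorem lintegral_translateIntegral [SecondCountableTopology V] [SFinite μ]
    [μ.IsAddHaarMeasure] [μ.IsNegInvariant] (hQ : MeasurableSet Q)
    {g : V → ℝ≥0∞} (hg : Measurable g) :
    ∫⁻ v, translateIntegral μ Q g v ∂μ = μ Q * ∫⁻ u, g u ∂μ := by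
  have h1 : Measurable (Q.indicator (1 : V → ℝ≥0∞)) := measurable_one.indicator hQ
  unfold translateIntegral
  rw [lintegral_lintegral_swap, ← lintegral_const_mul _ hg]
  · refine lintegral_congr fun u => ?_
    rw [lintegral_mul_const _ (by fun_prop),
      lintegral_indicator_sub_left hQ]
  · exact ((h1.comp (measurable_snd.sub measurable_fst)).mul
      (hg.comp measurable_snd)).aemeasurable

/-- A Gaussian average is controlled by a wider Gaussian average of the integrals over translates
of `Q`. -/
theorem lintegral_gaussianKernel_mul_le [SecondCountableTopology V] [SFinite μ]
    [μ.IsAddHaarMeasure] [μ.IsNegInvariant] (hQ : MeasurableSet Q)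
    {R a : ℝ} (ha : 0 ≤ a) (hR : ∀ x ∈ Q, ‖x‖ ≤ R) {g : V → ℝ≥0∞} (hg : Measurable g) (z : V) :
    μ Q * ∫⁻ u, gaussianKernel a (z - u) * g u ∂μ ≤ ENNReal.ofReal (Real.exp (a * R ^ 2)) *
      ∫⁻ v, gaussianKernel (a / 2) (z - v) * translateIntegral μ Q g v ∂μ := by
  have h1 : Measurable (Q.indicator (1 : V → ℝ≥0∞)) := measurable_one.indicator hQ
  have hm : Measurable fun u : V => gaussianKernel a (z - u) * g u := by fun_prop
  have hT : Measurable (translateIntegral μ Q g) := measurable_translateIntegral hQ hg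
  rw [← lintegral_translateIntegral hQ hm, ← lintegral_const_mul _ (by fun_prop)]
  refine lintegral_mono fun v => ?_
  unfold translateIntegral
  rw [← lintegral_const_mul _ (by fun_prop),
    ← lintegral_const_mul _ (by fun_prop)]
  refine lintegral_mono fun u => ?_
  by_cases h : u - v ∈ Q
  · simp only [Set.indicator_of_mem h, Pi.one_apply, one_mul]
    rw [← mul_assoc]
    gcongr
    refine gaussianKernel_le_of_norm_sub_le ha ?_
    rw [show z - u - (z - v) = -(u - v) by abel, norm_neg]
    exact hR _ h
  · simp [h]

variable {p : ℝ} {A : ℝ≥0∞} {ω σ : V → ℝ≥0∞}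

/-- The integrals of a weight over nearby translates of `Q` are comparable. -/
theorem translateIntegral_le_of_norm_sub_le [NormedSpace ℝ V] [μ.IsAddHaarMeasure]
    (hp : 1 < p) (hQ : MeasurableSet Q) {ρ : ℝ} (hρ : closedBall 0 ρ ⊆ Q)
    (hω : Measurable ω) (hσ : Measurable σ) (hdual : ∀ᵐ x ∂μ, ω x * σ x ^ (p - 1) = 1)
    (hA : ∀ v, translateIntegral μ Q ω v * translateIntegral μ Q σ v ^ (p - 1) ≤ A)
    {z z' : V} (hz : ‖z - z'‖ ≤ ρ) :
    μ (closedBall (0 : V) (ρ / 2)) ^ p * translateIntegral μ Q ω z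
      ≤ A * translateIntegral μ Q ω z' := by
  set m : V := midpoint ℝ z z' with hm
  set E : Set V := closedBall m (ρ / 2) with hE
  have hzE : E ⊆ {u | u - z ∈ Q} := fun u hu => hρ <| by
    have h1 : dist u m ≤ ρ / 2 := hu
    have h2 : dist m z ≤ ρ / 2 := by
      rw [hm, dist_midpoint_left, dist_eq_norm]
      norm_num
      linarith
    rw [mem_closedBall_zero_iff, ← dist_eq_norm]
    linarith [dist_triangle u m z]
  have hzE' : E ⊆ {u | u - z' ∈ Q} := fun u hu => hρ <| by
    have h1 : dist u m ≤ ρ / 2 := hu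
    have h2 : dist m z' ≤ ρ / 2 := by
      rw [hm, dist_midpoint_right, dist_eq_norm]
      norm_num
      linarith
    rw [mem_closedBall_zero_iff, ← dist_eq_norm]
    linarith [dist_triangle u m z']
  have hH := lintegral_rpow_le_of_dual_weight (μ := μ.restrict E) hp (g := fun _ => 1)
    aemeasurable_const hω.aemeasurable hσ.aemeasurable (ae_restrict_of_ae hdual)
  simp only [lintegral_const, ENNReal.one_rpow, one_mul, Measure.restrict_apply_univ] at hH
  have hball : μ E = μ (closedBall (0 : V) (ρ / 2)) := by
    rw [hE, Measure.addHaar_closedBall_center]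
  rw [hball] at hH
  have hp1 : 0 ≤ p - 1 := by linarith
  calc μ (closedBall (0 : V) (ρ / 2)) ^ p * translateIntegral μ Q ω z
      ≤ ((∫⁻ x in E, ω x ∂μ) * (∫⁻ x in E, σ x ∂μ) ^ (p - 1)) * translateIntegral μ Q ω z := by
        gcongr
    _ ≤ (translateIntegral μ Q ω z' * translateIntegral μ Q σ z ^ (p - 1)) *
          translateIntegral μ Q ω z := by
        rw [translateIntegral_eq_setLIntegral hQ ω z', translateIntegral_eq_setLIntegral hQ σ z]
        gcongr
    _ = (translateIntegral μ Q ω z * translateIntegral μ Q σ z ^ (p - 1)) *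
          translateIntegral μ Q ω z' := by ring
    _ ≤ A * translateIntegral μ Q ω z' := by gcongr; exact hA z

end Weights

section Boundedness

variable {V : Type*} [NormedAddCommGroup V] [InnerProductSpace ℝ V] [FiniteDimensional ℝ V]
  [MeasurableSpace V] [BorelSpace V] {Q : Set V} {p : ℝ} {A : ℝ≥0∞} {ω σ : V → ℝ≥0∞}

/-- The Gaussian average of an `A_p`-type weight is controlled by its local averages. -/
theorem exists_lintegral_gaussianKernel_mul_weight_le (hp : 1 < p) (hQ : MeasurableSet Q)
    {ρ R : ℝ} (hρ0 : 0 < ρ) (hρ : closedBall 0 ρ ⊆ Q) (hR : ∀ x ∈ Q, ‖x‖ ≤ R)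
    (hω : Measurable ω) (hσ : Measurable σ) (hdual : ∀ᵐ x, ω x * σ x ^ (p - 1) = 1)
    (hAt : A ≠ ∞)
    (hA : ∀ v, translateIntegral volume Q ω v * translateIntegral volume Q σ v ^ (p - 1) ≤ A)
    {a : ℝ} (ha : 0 < a) :
    ∃ c : ℝ≥0∞, c ≠ ∞ ∧ ∀ v, volume Q * ∫⁻ z, gaussianKernel a (v - z) * ω z
      ≤ c * translateIntegral volume Q ω v := by
  have hp0 : 0 < p := by linarith
  set δ : ℝ≥0∞ := volume (closedBall (0 : V) (ρ / 2)) ^ p with hδ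
  have hδ0 : δ ≠ 0 := by
    rw [hδ]
    exact (ENNReal.rpow_pos (measure_closedBall_pos _ _ (by positivity))
      measure_closedBall_lt_top.ne).ne'
  have hδt : δ ≠ ∞ := ENNReal.rpow_ne_top_of_nonneg hp0.le measure_closedBall_lt_top.ne
  set W := translateIntegral volume Q ω with hW
  have hlocal : ∀ z z', ‖z - z'‖ ≤ ρ → W z ≤ (δ⁻¹ * A) * W z' := fun z z' h => by
    rw [mul_assoc, ← ENNReal.mul_le_iff_le_inv hδ0 hδt]
    exact translateIntegral_le_of_norm_sub_le hp hQ hρ hω hσ hdual hA h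
  have hDt : δ⁻¹ * A ≠ ∞ := ENNReal.mul_ne_top (ENNReal.inv_ne_top.2 hδ0) hAt
  obtain ⟨c, hct, hc⟩ := exists_gaussianKernel_mul_pow_le (V := V) (half_pos ha) hρ0 hDt
  refine ⟨ENNReal.ofReal (Real.exp (a * R ^ 2)) * (c * ∫⁻ x : V, gaussianKernel (a / 2 / 2) x),
    ENNReal.mul_ne_top ENNReal.ofReal_ne_top (ENNReal.mul_ne_top hct
      (lintegral_gaussianKernel_ne_top (by positivity))), fun v => ?_⟩
  refine (lintegral_gaussianKernel_mul_le hQ ha.le hR hω v).trans ?_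
  rw [mul_assoc]
  gcongr
  rw [← lintegral_sub_left_eq_self (gaussianKernel (a / 2 / 2)) v,
    ← lintegral_const_mul _ (by fun_prop), ← lintegral_mul_const _ (by fun_prop)]
  refine lintegral_mono fun y => ?_
  calc gaussianKernel (a / 2) (v - y) * W y
      ≤ gaussianKernel (a / 2) (v - y) * ((δ⁻¹ * A) ^ ⌈‖y - v‖ / ρ⌉₊ * W v) := by
        gcongr
        exact le_pow_ceil_mul_of_local_le hρ0 hlocal y v
    _ = gaussianKernel (a / 2) (v - y) * (δ⁻¹ * A) ^ ⌈‖v - y‖ / ρ⌉₊ * W v := by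
        rw [norm_sub_rev y v, mul_assoc]
    _ ≤ c * gaussianKernel (a / 2 / 2) (v - y) * W v := by
        exact mul_le_mul_left (hc _) _

/-- Gaussian convolution is bounded on `L^p(ω)` for weights satisfying a local `A_p` condition. -/
theorem exists_lintegral_gaussian_convolution_rpow_le (hp : 1 < p) (hQ : MeasurableSet Q)
    {ρ R : ℝ} (hρ0 : 0 < ρ) (hρ : closedBall 0 ρ ⊆ Q) (hR : ∀ x ∈ Q, ‖x‖ ≤ R)
    (hω : Measurable ω) (hσ : Measurable σ) (hdual : ∀ᵐ x, ω x * σ x ^ (p - 1) = 1)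
    (hAt : A ≠ ∞)
    (hA : ∀ v, translateIntegral volume Q ω v * translateIntegral volume Q σ v ^ (p - 1) ≤ A)
    {a : ℝ} (ha : 0 < a) :
    ∃ C : ℝ≥0∞, C ≠ ∞ ∧ ∀ g : V → ℝ≥0∞, Measurable g →
      ∫⁻ z, (∫⁻ u, gaussianKernel a (z - u) * g u) ^ p * ω z ≤ C * ∫⁻ z, g z ^ p * ω z := by
  have hp0 : 0 < p := by linarith
  have hp1 : 0 ≤ p - 1 := by linarith
  have hQ0 : volume Q ≠ 0 :=
    ((measure_closedBall_pos volume (0 : V) hρ0).trans_le (measure_mono hρ)).ne'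
  have hQt : volume Q ≠ ∞ := ((measure_mono fun x hx =>
    mem_closedBall_zero_iff.2 (hR x hx)).trans_lt
      (measure_closedBall_lt_top (x := (0 : V)) (r := R))).ne
  obtain ⟨c, hct, hc⟩ := exists_lintegral_gaussianKernel_mul_weight_le hp hQ hρ0 hρ hR hω hσ
    hdual hAt hA (half_pos ha)
  set I : ℝ≥0∞ := ∫⁻ x : V, gaussianKernel (a / 2) x with hI
  have hIt : I ≠ ∞ := lintegral_gaussianKernel_ne_top (half_pos ha)
  set c₁ : ℝ≥0∞ := (volume Q)⁻¹ * ENNReal.ofReal (Real.exp (a * R ^ 2)) with hc₁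
  have hc₁t : c₁ ≠ ∞ := ENNReal.mul_ne_top (ENNReal.inv_ne_top.2 hQ0) ENNReal.ofReal_ne_top
  set c₂ : ℝ≥0∞ := (volume Q)⁻¹ * c with hc₂
  have hc₂t : c₂ ≠ ∞ := ENNReal.mul_ne_top (ENNReal.inv_ne_top.2 hQ0) hct
  refine ⟨c₁ ^ p * I ^ (p - 1) * (c₂ * A * volume Q), ?_, fun g hg => ?_⟩
  · exact ENNReal.mul_ne_top (ENNReal.mul_ne_top (ENNReal.rpow_ne_top_of_nonneg hp0.le hc₁t)
      (ENNReal.rpow_ne_top_of_nonneg hp1 hIt))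
      (ENNReal.mul_ne_top (ENNReal.mul_ne_top hc₂t hAt) hQt)
  set F := translateIntegral volume Q g with hF
  set W := translateIntegral volume Q ω with hW
  set S := translateIntegral volume Q σ with hS
  set G := translateIntegral volume Q (fun z => g z ^ p * ω z) with hG
  have hFm : Measurable F := measurable_translateIntegral hQ hg
  have hGm : Measurable G := measurable_translateIntegral hQ ((hg.pow_const p).mul hω)
  have hSm : Measurable S := measurable_translateIntegral hQ hσ
  have hFG : ∀ v, F v ^ p ≤ G v * S v ^ (p - 1) := fun v => by
    rw [hF, hG, hS]
    simp only [translateIntegral_eq_setLIntegral hQ]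
    exact lintegral_rpow_le_of_dual_weight hp hg.aemeasurable hω.aemeasurable
      hσ.aemeasurable (ae_restrict_of_ae hdual)
  have hpoint : ∀ z, (∫⁻ u, gaussianKernel a (z - u) * g u) ^ p ≤ c₁ ^ p * I ^ (p - 1) *
      ∫⁻ v, gaussianKernel (a / 2) (z - v) * (G v * S v ^ (p - 1)) := fun z => by
    have h1 : ∫⁻ u, gaussianKernel a (z - u) * g u
        ≤ c₁ * ∫⁻ v, gaussianKernel (a / 2) (z - v) * F v := by
      rw [hc₁, mul_assoc, ← ENNReal.mul_le_iff_le_inv hQ0 hQt]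
      exact lintegral_gaussianKernel_mul_le hQ ha.le hR hg z
    calc (∫⁻ u, gaussianKernel a (z - u) * g u) ^ p
        ≤ (c₁ * ∫⁻ v, gaussianKernel (a / 2) (z - v) * F v) ^ p := by gcongr
      _ = c₁ ^ p * (∫⁻ v, gaussianKernel (a / 2) (z - v) * F v) ^ p :=
          ENNReal.mul_rpow_of_nonneg _ _ hp0.le
      _ ≤ c₁ ^ p * ((∫⁻ v, gaussianKernel (a / 2) (z - v) * F v ^ p) *
            (∫⁻ v, gaussianKernel (a / 2) (z - v)) ^ (p - 1)) := by
          gcongr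
          exact lintegral_mul_rpow_le hp (by fun_prop) hFm
            (fun _ => gaussianKernel_ne_zero _ _) (fun _ => gaussianKernel_ne_top _ _)
      _ ≤ c₁ ^ p * ((∫⁻ v, gaussianKernel (a / 2) (z - v) * (G v * S v ^ (p - 1))) *
            I ^ (p - 1)) := by
          rw [lintegral_sub_left_eq_self (fun x => gaussianKernel (a / 2) x) z]
          gcongr
          exact hFG _
      _ = _ := by ring
  have hweight : ∀ v, ∫⁻ z, gaussianKernel (a / 2) (z - v) * ω z ≤ c₂ * W v := fun v => by
    rw [hc₂, mul_assoc, ← ENNReal.mul_le_iff_le_inv hQ0 hQt]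
    refine le_of_eq_of_le ?_ (hc v)
    congr 1
    refine lintegral_congr fun z => ?_
    rw [← gaussianKernel_neg, neg_sub]
  have hH : Measurable fun v => G v * S v ^ (p - 1) := hGm.mul (hSm.pow_const _)
  have hinner : Measurable fun q : V × V =>
      gaussianKernel (a / 2) (q.1 - q.2) * (G q.2 * S q.2 ^ (p - 1)) :=
    ((measurable_gaussianKernel _).comp (measurable_fst.sub measurable_snd)).mul
      (hH.comp measurable_snd)
  calc ∫⁻ z, (∫⁻ u, gaussianKernel a (z - u) * g u) ^ p * ω z
      ≤ ∫⁻ z, c₁ ^ p * I ^ (p - 1) *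
          ((∫⁻ v, gaussianKernel (a / 2) (z - v) * (G v * S v ^ (p - 1))) * ω z) := by
        refine lintegral_mono fun z => ?_
        rw [← mul_assoc]
        gcongr
        exact hpoint z
    _ = c₁ ^ p * I ^ (p - 1) *
          ∫⁻ z, ∫⁻ v, gaussianKernel (a / 2) (z - v) * (G v * S v ^ (p - 1)) * ω z := by
        have hm : Measurable fun z =>
            ∫⁻ v, gaussianKernel (a / 2) (z - v) * (G v * S v ^ (p - 1)) :=
          hinner.lintegral_prod_right'
        rw [lintegral_const_mul _ (by fun_prop)]
        congr 1
        refine lintegral_congr fun z => ?_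
        rw [lintegral_mul_const _ (by fun_prop)]
    _ = c₁ ^ p * I ^ (p - 1) *
          ∫⁻ v, G v * S v ^ (p - 1) * ∫⁻ z, gaussianKernel (a / 2) (z - v) * ω z := by
        rw [lintegral_lintegral_swap (hinner.mul (hω.comp measurable_fst)).aemeasurable]
        congr 1
        refine lintegral_congr fun v => ?_
        rw [← lintegral_const_mul _ (by fun_prop)]
        refine lintegral_congr fun z => ?_
        ring
    _ ≤ c₁ ^ p * I ^ (p - 1) * ∫⁻ v, (c₂ * A) * G v := by
        refine mul_le_mul_right (lintegral_mono fun v => ?_) _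
        calc G v * S v ^ (p - 1) * ∫⁻ z, gaussianKernel (a / 2) (z - v) * ω z
            ≤ G v * S v ^ (p - 1) * (c₂ * W v) := by gcongr; exact hweight v
          _ = c₂ * (W v * S v ^ (p - 1)) * G v := by ring
          _ ≤ c₂ * A * G v := by gcongr; exact hA v
    _ = c₁ ^ p * I ^ (p - 1) * (c₂ * A * volume Q) * ∫⁻ z, g z ^ p * ω z := by
        rw [lintegral_const_mul _ hGm, hG,
          lintegral_translateIntegral hQ (by fun_prop)]
        ring

end Boundedness

section Cube

variable {n : ℕ} {r : ℝ}

theorem cube_eq_translate (z : En n) : cube n r z = {u | u - z ∈ cube n r 0} := by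
  ext u
  simp [cube]

theorem measurableSet_cube (z : En n) : MeasurableSet (cube n r z) := by
  refine IsClosed.measurableSet ?_
  simp only [cube, Set.ofPred_forall, Set.ofPred_and]
  refine isClosed_iInter fun j => IsClosed.inter ?_ ?_ <;>
    exact isClosed_le (by fun_prop) continuous_const

theorem closedBall_subset_cube : closedBall (0 : En n) (r / 2) ⊆ cube n r 0 := fun u hu j => by
  have h1 : ‖u j‖ ≤ r / 2 := (PiLp.norm_apply_le u j).trans (mem_closedBall_zero_iff.1 hu)
  simpa using ⟨(Complex.abs_re_le_norm _).trans h1, (Complex.abs_im_le_norm _).trans h1⟩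

theorem norm_le_of_mem_cube {u : En n} (hu : u ∈ cube n r 0) : ‖u‖ ≤ √(n * r ^ 2) := by
  rw [EuclideanSpace.norm_eq]
  refine Real.sqrt_le_sqrt ?_
  have h : ∀ j ∈ Finset.univ, ‖u j‖ ^ 2 ≤ r ^ 2 := fun j _ => by
    have h1 := hu j
    simp only [PiLp.zero_apply, Complex.zero_re, Complex.zero_im, sub_zero] at h1
    exact pow_le_pow_left₀ (norm_nonneg _)
      ((Complex.norm_le_abs_re_add_abs_im _).trans (by linarith)) 2
  simpa using Finset.sum_le_card_nsmul _ _ _ h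

theorem volume_cube (z : En n) : volume (cube n r z) = volume (cube n r 0) := by
  rw [cube_eq_translate z]
  simp only [sub_eq_add_neg]
  exact measure_preimage_add_right volume (-z) (cube n r 0)

end Cube

/-- if `w ∈ A_{p,r}` then the operator
`H_α f(z) = ∫ e^{-(α/2)|z-u|²} f(u) dv(u)` is bounded on `L^p(ℂⁿ, w dv)`. -/
theorem Hα_bounded_of_Apr (n : ℕ) (hn : 1 ≤ n) (p α r : ℝ) (hp : 1 < p)
    (hα : 0 < α) (hr : 0 < r) (w : En n → ℝ) (hw : IsWeight n w)
    (hApr : MemApr n p r w) :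
    ∃ C : ℝ, 0 < C ∧ ∀ f : En n → ℝ, Measurable f → (∀ z, 0 ≤ f z) →
      (∫⁻ z : En n,
          (∫⁻ u : En n, ENNReal.ofReal (Real.exp (-(α / 2) * ‖z - u‖ ^ 2)) *
            ENNReal.ofReal (f u)) ^ p * ENNReal.ofReal (w z))
        ≤ ENNReal.ofReal C *
            ∫⁻ z : En n, ENNReal.ofReal (f z) ^ p * ENNReal.ofReal (w z) := by
  have hp1 : 0 < p - 1 := by linarith
  obtain ⟨hwm, hwpos, -⟩ := hw
  obtain ⟨B, hB⟩ := hApr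
  set Q : Set (En n) := cube n r 0 with hQdef
  have hQ : MeasurableSet Q := measurableSet_cube 0
  have hQ0 : volume Q ≠ 0 := ((measure_closedBall_pos volume (0 : En n) (half_pos hr)).trans_le
    (measure_mono closedBall_subset_cube)).ne'
  have hQt : volume Q ≠ ∞ := ((measure_mono fun x hx =>
    mem_closedBall_zero_iff.2 (norm_le_of_mem_cube hx)).trans_lt
      (measure_closedBall_lt_top (x := (0 : En n)) (r := √(n * r ^ 2)))).ne
  set ω : En n → ℝ≥0∞ := fun z => ENNReal.ofReal (w z) with hω
  set σ : En n → ℝ≥0∞ := fun z => ENNReal.ofReal (w z ^ (-(1 / (p - 1)))) with hσ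
  have hdual : ∀ᵐ z : En n, ω z * σ z ^ (p - 1) = 1 := by
    filter_upwards [hwpos] with z hz
    simp only [hω, hσ]
    rw [ENNReal.ofReal_rpow_of_nonneg (Real.rpow_nonneg hz.le _) hp1.le, ← Real.rpow_mul hz.le,
      ← ENNReal.ofReal_mul hz.le, neg_mul, one_div_mul_cancel hp1.ne', Real.rpow_neg_one,
      mul_inv_cancel₀ hz.ne', ENNReal.ofReal_one]
  have hA : ∀ v, translateIntegral volume Q ω v * translateIntegral volume Q σ v ^ (p - 1)
      ≤ volume Q * volume Q ^ (p - 1) * ENNReal.ofReal B := fun v => by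
    have h := hB v
    rw [volume_cube v, cube_eq_translate v, ← hQdef, ← translateIntegral_eq_setLIntegral hQ,
      ← translateIntegral_eq_setLIntegral hQ, ENNReal.mul_rpow_of_nonneg _ _ hp1.le,
      ENNReal.inv_rpow, mul_mul_mul_comm, ← ENNReal.mul_inv (.inl hQ0) (.inl hQt)] at h
    have hQp : volume Q ^ (p - 1) ≠ ∞ := ENNReal.rpow_ne_top_of_nonneg hp1.le hQt
    have hQp0 : volume Q ^ (p - 1) ≠ 0 := (ENNReal.rpow_pos (pos_iff_ne_zero.2 hQ0) hQt).ne'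
    exact (ENNReal.inv_mul_le_iff (mul_ne_zero hQ0 hQp0)
      (ENNReal.mul_ne_top hQt hQp)).1 h
  obtain ⟨C, hCt, hC⟩ := exists_lintegral_gaussian_convolution_rpow_le hp hQ (half_pos hr)
    closedBall_subset_cube (fun x hx => norm_le_of_mem_cube hx) (by fun_prop) (by fun_prop)
    hdual (ENNReal.mul_ne_top (ENNReal.mul_ne_top hQt (ENNReal.rpow_ne_top_of_nonneg hp1.le hQt))
      ENNReal.ofReal_ne_top) hA (half_pos hα)
  refine ⟨C.toReal + 1, by positivity, fun f hf _ => ?_⟩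
  refine (hC (fun z => ENNReal.ofReal (f z)) (by fun_prop)).trans ?_
  refine mul_le_mul_left ?_ _
  conv_lhs => rw [← ENNReal.ofReal_toReal hCt]
  exact ENNReal.ofReal_le_ofReal (by linarith)

end
end

section
/- Let n ≥ 1, p > 1, and let w be a weight on ℂⁿ belonging to A_{p,r} for some r > 0. Then log w ∈ BMO¹: log w is locally integrable and there exists a constant C > 0 such that for every z ∈ ℂⁿ, v(B(z,1))^{-1} ∫_{B(z,1)} | log w - (log w)_{B(z,1)} | dv ≤ C, where (log w)_{B(z,1)} = v(B(z,1))^{-1} ∫_{B(z,1)} log w dv. -/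
open MeasureTheory ENNReal Metric

noncomputable section

theorem abs_sub_le_of_dist_le_nat_mul {E : Type*} [NormedAddCommGroup E] [NormedSpace ℝ E]
    {c : E → ℝ} {δ D : ℝ} (h : ∀ x y, dist x y ≤ δ → |c x - c y| ≤ D) (N : ℕ) (x y : E)
    (hxy : dist x y ≤ N * δ) : |c x - c y| ≤ N * D := by
  induction N generalizing y with
  | zero =>
    have : x = y := by simpa using hxy
    simp [this]
  | succ N ih =>
    have hN : (0 : ℝ) < N + 1 := by positivity
    push_cast at hxy ⊢
    set y' : E := AffineMap.lineMap x y ((N : ℝ) / (N + 1))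
    have h1 : dist x y' ≤ N * δ := by
      rw [dist_left_lineMap, Real.norm_of_nonneg (by positivity), div_mul_eq_mul_div,
        div_le_iff₀ hN]
      nlinarith [mul_le_mul_of_nonneg_left hxy (Nat.cast_nonneg (α := ℝ) N)]
    have h2 : dist y' y ≤ δ := by
      have h3 : 1 - (N : ℝ) / (N + 1) = 1 / (N + 1) := by field_simp; ring
      rw [dist_lineMap_right, h3, Real.norm_of_nonneg (by positivity), div_mul_eq_mul_div,
        div_le_iff₀ hN]
      linarith
    have h4 := abs_sub_le (c x) (c y') (c y)
    linarith [ih y' h1, h y' y h2]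

section MeanOscillation

variable {E : Type*} [NormedAddCommGroup E] [MeasurableSpace E] [BorelSpace E]
  {μ : Measure E} [μ.IsAddHaarMeasure] {f : E → ℝ} {c : E → ℝ} {δ K : ℝ}

theorem addHaar_real_ball_eq_zero_center (x : E) (r : ℝ) :
    μ.real (ball x r) = μ.real (ball 0 r) := by
  simp [Measure.real, Measure.addHaar_ball_center μ x r]

variable [ProperSpace E]

theorem setIntegral_abs_sub_const_le {x : E} {r a b M : ℝ} (hf : LocallyIntegrable f μ)
    (h : ∫ y in ball x r, |f y - a| ∂μ ≤ M) :
    ∫ y in ball x r, |f y - b| ∂μ ≤ M + |a - b| * μ.real (ball 0 r) := by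
  have hi : ∀ a : ℝ, IntegrableOn (fun y => f y - a) (ball x r) μ := fun a =>
    ((hf.integrableOn_isCompact (isCompact_closedBall x r)).mono_set
      ball_subset_closedBall).sub (integrableOn_const measure_ball_lt_top.ne)
  have hc : IntegrableOn (fun _ => |a - b|) (ball x r) μ :=
    integrableOn_const measure_ball_lt_top.ne
  calc ∫ y in ball x r, |f y - b| ∂μ
      ≤ ∫ y in ball x r, (|f y - a| + |a - b|) ∂μ :=
        integral_mono (hi b).abs ((hi a).abs.add hc) fun y => abs_sub_le _ _ _
    _ = ∫ y in ball x r, |f y - a| ∂μ + |a - b| * μ.real (ball 0 r) := by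
        rw [integral_add (hi a).abs hc, setIntegral_const, addHaar_real_ball_eq_zero_center,
          smul_eq_mul, mul_comm]
    _ ≤ _ := by linarith

theorem abs_sub_mul_measureReal_ball_le (hδ : 0 < δ) (hf : LocallyIntegrable f μ)
    (hc : ∀ x, ∫ y in ball x δ, |f y - c x| ∂μ ≤ K) {x y : E} (hxy : dist x y ≤ δ / 2) :
    |c x - c y| * μ.real (ball 0 (δ / 2)) ≤ 2 * K := by
  have hi : ∀ (z : E) (a r : ℝ), IntegrableOn (fun y => f y - a) (ball z r) μ := fun z a r =>
    ((hf.integrableOn_isCompact (isCompact_closedBall z r)).mono_set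
      ball_subset_closedBall).sub (integrableOn_const measure_ball_lt_top.ne)
  have hmono : ∀ z, ball x (δ / 2) ⊆ ball z δ →
      ∫ y in ball x (δ / 2), |f y - c z| ∂μ ≤ K := fun z hz =>
    (setIntegral_mono_set (hi z (c z) δ).abs (.of_forall fun _ => abs_nonneg _)
      hz.eventuallyLE).trans (hc z)
  have hx := hmono x (ball_subset_ball (by linarith))
  have hy := hmono y (ball_subset_ball' (by linarith))
  calc |c x - c y| * μ.real (ball 0 (δ / 2))
      = ∫ _ in ball x (δ / 2), |c x - c y| ∂μ := by
        rw [setIntegral_const, addHaar_real_ball_eq_zero_center x, smul_eq_mul, mul_comm]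
    _ ≤ ∫ z in ball x (δ / 2), (|f z - c x| + |f z - c y|) ∂μ := by
        refine integral_mono (integrableOn_const measure_ball_lt_top.ne)
          ((hi _ _ _).abs.add (hi _ _ _).abs) fun z => ?_
        have := abs_sub_le (c x) (f z) (c y)
        rwa [abs_sub_comm (c x) (f z)] at this
    _ = ∫ z in ball x (δ / 2), |f z - c x| ∂μ + ∫ z in ball x (δ / 2), |f z - c y| ∂μ :=
        integral_add (hi _ _ _).abs (hi _ _ _).abs
    _ ≤ 2 * K := by linarith

theorem setIntegral_abs_sub_average_le {x : E} {r a M : ℝ} (hr : 0 < r)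
    (hf : LocallyIntegrable f μ) (h : ∫ y in ball x r, |f y - a| ∂μ ≤ M) :
    ∫ y in ball x r, |f y - (μ.real (ball x r))⁻¹ * ∫ z in ball x r, f z ∂μ| ∂μ ≤ 2 * M := by
  have hV : 0 < μ.real (ball x r) :=
    ENNReal.toReal_pos (measure_ball_pos μ x hr).ne' measure_ball_lt_top.ne
  have hfi : IntegrableOn f (ball x r) μ :=
    (hf.integrableOn_isCompact (isCompact_closedBall x r)).mono_set ball_subset_closedBall
  set b := (μ.real (ball x r))⁻¹ * ∫ z in ball x r, f z ∂μ with hb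
  have hab : |a - b| * μ.real (ball 0 r) ≤ M := by
    have h1 : ∫ y in ball x r, (f y - a) ∂μ = (b - a) * μ.real (ball x r) := by
      rw [integral_sub hfi (integrableOn_const measure_ball_lt_top.ne), setIntegral_const,
        smul_eq_mul, hb]
      field_simp
    rw [← addHaar_real_ball_eq_zero_center x r, abs_sub_comm, ← abs_of_pos hV, ← abs_mul, ← h1]
    exact (abs_integral_le_integral_abs).trans h
  linarith [setIntegral_abs_sub_const_le (b := b) hf h]

variable [NormedSpace ℝ E]

theorem exists_forall_setIntegral_abs_sub_le (hδ : 0 < δ) (hf : LocallyIntegrable f μ)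
    (hc : ∀ x, ∫ y in ball x δ, |f y - c x| ∂μ ≤ K) (R : ℝ) :
    ∃ M, ∀ x, ∫ y in ball x R, |f y - c x| ∂μ ≤ M := by
  have hm : 0 < μ.real (ball (0 : E) (δ / 2)) :=
    ENNReal.toReal_pos (measure_ball_pos μ 0 (half_pos hδ)).ne' measure_ball_lt_top.ne
  set D := 2 * K / μ.real (ball (0 : E) (δ / 2))
  have hD : ∀ x y, dist x y ≤ δ / 2 → |c x - c y| ≤ D := fun x y hxy =>
    (le_div_iff₀ hm).2 (abs_sub_mul_measureReal_ball_le hδ hf hc hxy)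
  obtain ⟨N, hN⟩ := exists_nat_ge (R / (δ / 2))
  rw [div_le_iff₀ (half_pos hδ)] at hN
  obtain ⟨t, htR, htf, ht⟩ := finite_cover_balls_of_compact (isCompact_closedBall (0 : E) R) hδ
  refine ⟨∑ _i ∈ htf.toFinset, (K + N * D * μ.real (ball (0 : E) δ)), fun x => ?_⟩
  have hi : ∀ (z : E) (a r : ℝ), IntegrableOn (fun y => f y - a) (ball z r) μ := fun z a r =>
    ((hf.integrableOn_isCompact (isCompact_closedBall z r)).mono_set
      ball_subset_closedBall).sub (integrableOn_const measure_ball_lt_top.ne)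
  have hcover : ball x R ⊆ ⋃ i ∈ htf.toFinset, ball (x + i) δ := by
    intro y hy
    have : y - x ∈ closedBall (0 : E) R := by
      simpa [dist_eq_norm] using (mem_ball.1 hy).le
    obtain ⟨i, hit, hi⟩ := Set.mem_iUnion₂.1 (ht this)
    refine Set.mem_iUnion₂.2 ⟨i, htf.mem_toFinset.2 hit, ?_⟩
    rw [mem_ball, dist_eq_norm] at hi ⊢
    rwa [← sub_sub]
  have hle : μ.restrict (ball x R) ≤ ∑ i ∈ htf.toFinset, μ.restrict (ball (x + i) δ) := by
    refine (Measure.restrict_mono_set μ hcover).trans ?_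
    refine Measure.le_iff.2 fun s hs => ?_
    rw [Measure.restrict_apply hs, Measure.finsetSum_apply, Set.inter_iUnion₂]
    simp only [Measure.restrict_apply hs]
    exact measure_biUnion_finset_le _ _
  have hint : ∀ i ∈ htf.toFinset,
      Integrable (fun y => |f y - c x|) (μ.restrict (ball (x + i) δ)) :=
    fun i _ => (hi _ _ _).abs
  calc ∫ y in ball x R, |f y - c x| ∂μ
      ≤ ∫ y, |f y - c x| ∂(∑ i ∈ htf.toFinset, μ.restrict (ball (x + i) δ)) :=
        integral_mono_measure hle (.of_forall fun _ => abs_nonneg _)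
          (integrable_finsetSum_measure.2 hint)
    _ = ∑ i ∈ htf.toFinset, ∫ y in ball (x + i) δ, |f y - c x| ∂μ :=
        integral_finsetSum_measure hint
    _ ≤ ∑ _i ∈ htf.toFinset, (K + N * D * μ.real (ball (0 : E) δ)) := by
        refine Finset.sum_le_sum fun i hi => ?_
        have hiR : ‖i‖ ≤ R := by simpa using htR (htf.mem_toFinset.1 hi)
        refine (setIntegral_abs_sub_const_le hf (hc (x + i))).trans ?_
        gcongr
        exact abs_sub_le_of_dist_le_nat_mul hD N _ _ (by simpa using hiR.trans hN)

end MeanOscillation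

theorem abs_le_exp_add_inv_mul_exp {s : ℝ} (hs : 0 < s) (t : ℝ) :
    |t| ≤ Real.exp t + s⁻¹ * Real.exp (-(s * t)) := by
  have h1 := Real.add_one_le_exp t
  have h2 : s⁻¹ * (-(s * t)) ≤ s⁻¹ * Real.exp (-(s * t)) := by
    gcongr
    linarith [Real.add_one_le_exp (-(s * t))]
  have h3 : s⁻¹ * (-(s * t)) = -t := by field_simp
  have h4 : 0 < s⁻¹ * Real.exp (-(s * t)) := by positivity
  have h5 := Real.exp_pos t
  rw [abs_le]
  constructor <;> linarith

/-- A weight with bounded Muckenhoupt product on a set `Q` has logarithm of bounded mean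
oscillation on `Q`, with a bound depending only on the product. -/
theorem exists_lintegral_abs_log_sub_le {α : Type*} [MeasurableSpace α] {μ : Measure α}
    {Q : Set α} (hQ0 : μ Q ≠ 0) (hQ : μ Q ≠ ∞) {w : α → ℝ} (hw : Measurable w)
    (hpos : ∀ᵐ x ∂μ, 0 < w x) (hwQ : IntegrableOn w Q μ) {s : ℝ} (hs : 0 < s) {C : ℝ≥0∞}
    (hC : ((μ Q)⁻¹ * ∫⁻ x in Q, ENNReal.ofReal (w x) ∂μ) *
      ((μ Q)⁻¹ * ∫⁻ x in Q, ENNReal.ofReal (w x ^ (-s)) ∂μ) ^ s⁻¹ ≤ C) :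
    ∃ c : ℝ, ∫⁻ x in Q, ENNReal.ofReal |Real.log (w x) - c| ∂μ ≤
      μ Q * (1 + ENNReal.ofReal s⁻¹ * C ^ s) := by
  set I := ∫⁻ x in Q, ENNReal.ofReal (w x) ∂μ with hI
  set J := ∫⁻ x in Q, ENNReal.ofReal (w x ^ (-s)) ∂μ with hJ
  have hmI : Measurable fun x => ENNReal.ofReal (w x) := hw.ennreal_ofReal
  have hI_top : I ≠ ∞ := hwQ.lintegral_lt_top.ne
  have hI0 : I ≠ 0 := by
    rw [hI, Ne, lintegral_eq_zero_iff hmI]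
    intro h
    have hF : ∀ᵐ x ∂μ.restrict Q, False := by
      filter_upwards [h, ae_restrict_of_ae hpos] with x hx hx'
      simp only [Pi.zero_apply, ENNReal.ofReal_eq_zero] at hx
      linarith
    simp [hQ0] at hF
  set A := (μ Q)⁻¹ * I with hA
  have hA_top : A ≠ ∞ := ENNReal.mul_ne_top (ENNReal.inv_ne_top.2 hQ0) hI_top
  have hA0 : A ≠ 0 := mul_ne_zero (ENNReal.inv_ne_zero.2 hQ) hI0
  set a := A.toReal with ha
  have ha0 : 0 < a := ENNReal.toReal_pos hA0 hA_top
  have hAa : ENNReal.ofReal a = A := ENNReal.ofReal_toReal hA_top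
  have hVI : I = μ Q * A := by rw [hA, ← mul_assoc, ENNReal.mul_inv_cancel hQ0 hQ, one_mul]
  have hVJ : J = μ Q * ((μ Q)⁻¹ * J) := by
    rw [← mul_assoc, ENNReal.mul_inv_cancel hQ0 hQ, one_mul]
  have hpt : ∀ᵐ x ∂μ.restrict Q, ENNReal.ofReal |Real.log (w x) - Real.log a| ≤
      A⁻¹ * ENNReal.ofReal (w x) +
        ENNReal.ofReal s⁻¹ * A ^ s * ENNReal.ofReal (w x ^ (-s)) := by
    filter_upwards [ae_restrict_of_ae hpos] with x hx
    have h := abs_le_exp_add_inv_mul_exp hs (Real.log (w x) - Real.log a)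
    have h1 : Real.exp (Real.log (w x) - Real.log a) = a⁻¹ * w x := by
      rw [Real.exp_sub, Real.exp_log hx, Real.exp_log ha0]
      field_simp
    have h2 : Real.exp (-(s * (Real.log (w x) - Real.log a))) = a ^ s * w x ^ (-s) := by
      rw [Real.rpow_def_of_pos ha0, Real.rpow_def_of_pos hx, ← Real.exp_add]
      ring_nf
    rw [h1, h2, ← mul_assoc] at h
    rw [← hAa, ← ENNReal.ofReal_inv_of_pos ha0, ENNReal.ofReal_rpow_of_pos ha0,
      ← ENNReal.ofReal_mul (by positivity), ← ENNReal.ofReal_mul (by positivity),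
      ← ENNReal.ofReal_mul (by positivity), ← ENNReal.ofReal_add (by positivity) (by positivity)]
    exact ENNReal.ofReal_le_ofReal h
  have hAJ : A ^ s * ((μ Q)⁻¹ * J) ≤ C ^ s := by
    have h := ENNReal.rpow_le_rpow hC hs.le
    rwa [ENNReal.mul_rpow_of_nonneg _ _ hs.le, ← ENNReal.rpow_mul, inv_mul_cancel₀ hs.ne',
      ENNReal.rpow_one] at h
  refine ⟨Real.log a, (lintegral_mono_ae hpt).trans ?_⟩
  rw [lintegral_add_left (hmI.const_mul _), lintegral_const_mul _ hmI,
    lintegral_const_mul _ (hw.pow_const _).ennreal_ofReal, ← hI, ← hJ]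
  calc A⁻¹ * I + ENNReal.ofReal s⁻¹ * A ^ s * J
      = μ Q * (A⁻¹ * A + ENNReal.ofReal s⁻¹ * (A ^ s * ((μ Q)⁻¹ * J))) := by
        nth_rw 1 [hVI, hVJ]
        ring
    _ ≤ _ := by
        rw [ENNReal.inv_mul_cancel hA0 hA_top]
        gcongr

theorem isClosed_cube (n : ℕ) (r : ℝ) (z : En n) : IsClosed (cube n r z) := by
  simp only [cube, Set.ofPred_forall, Set.ofPred_and]
  refine isClosed_iInter fun j => .inter ?_ ?_ <;>
    exact isClosed_le (by fun_prop) continuous_const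

theorem ball_subset_cube (n : ℕ) (r : ℝ) (z : En n) : ball z (r / 2) ⊆ cube n r z := by
  intro u hu j
  rw [mem_ball, dist_eq_norm] at hu
  have h := (PiLp.norm_apply_le (u - z) j).trans hu.le
  simp only [PiLp.sub_apply] at h
  rw [← Complex.sub_re, ← Complex.sub_im]
  exact ⟨(Complex.abs_re_le_norm _).trans h, (Complex.abs_im_le_norm _).trans h⟩

theorem isCompact_cube (n : ℕ) (r : ℝ) (z : En n) : IsCompact (cube n r z) := by
  refine isCompact_of_isClosed_isBounded (isClosed_cube n r z)
    (isBounded_closedBall.subset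
      (?_ : cube n r z ⊆ closedBall z √(∑ _j : Fin n, (r / 2 + r / 2) ^ 2)))
  intro u hu
  rw [mem_closedBall, dist_eq_norm, EuclideanSpace.norm_eq]
  refine Real.sqrt_le_sqrt (Finset.sum_le_sum fun j _ => ?_)
  refine pow_le_pow_left₀ (norm_nonneg _) ((Complex.norm_le_abs_re_add_abs_im _).trans ?_) 2
  simpa using add_le_add (hu j).1 (hu j).2

theorem volume_cube_eq_zero_center (n : ℕ) (r : ℝ) (z : En n) :
    volume (cube n r z) = volume (cube n r 0) := by
  rw [← measure_preimage_add_right volume z (cube n r z)]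
  congr 1
  ext u
  simp [cube]

theorem volume_cube_ne_zero (n : ℕ) {r : ℝ} (hr : 0 < r) (z : En n) :
    volume (cube n r z) ≠ 0 :=
  ((measure_ball_pos volume z (half_pos hr)).trans_le
    (measure_mono (ball_subset_cube n r z))).ne'

/-- if `w ∈ A_{p,r}` for some `r > 0` then `log w ∈ BMO¹`
(with respect to Euclidean balls of radius `1`). -/
theorem log_BMO_of_Apr (n : ℕ) (hn : 1 ≤ n) (p : ℝ) (hp : 1 < p) (w : En n → ℝ)
    (hw : IsWeight n w) (hApr : ∃ r : ℝ, 0 < r ∧ MemApr n p r w) :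
    LocallyIntegrable (fun z => Real.log (w z)) volume ∧
      ∃ C : ℝ, 0 < C ∧ ∀ z : En n,
        (volume (ball z 1)).toReal⁻¹ *
            ∫ u in ball z 1,
              |Real.log (w u) -
                (volume (ball z 1)).toReal⁻¹ * ∫ v in ball z 1, Real.log (w v)|
          ≤ C := by
  obtain ⟨hwm, hwpos, hwloc⟩ := hw
  obtain ⟨r, hr, C, hC⟩ := hApr
  have hs : 0 < 1 / (p - 1) := one_div_pos.2 (sub_pos.2 hp)
  have hosc : ∀ z, ∃ c : ℝ, ∫⁻ x in cube n r z, ENNReal.ofReal |Real.log (w x) - c| ≤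
      volume (cube n r 0) *
        (1 + ENNReal.ofReal (1 / (p - 1))⁻¹ * ENNReal.ofReal C ^ (1 / (p - 1))) := fun z => by
    rw [← volume_cube_eq_zero_center n r z]
    refine exists_lintegral_abs_log_sub_le (volume_cube_ne_zero n hr z)
      (isCompact_cube n r z).measure_lt_top.ne hwm hwpos
      (hwloc.integrableOn_isCompact (isCompact_cube n r z)) hs ?_
    simpa using hC z
  choose c hc using hosc
  set K := volume (cube n r 0) *
    (1 + ENNReal.ofReal (1 / (p - 1))⁻¹ * ENNReal.ofReal C ^ (1 / (p - 1)))
  have hK : K ≠ ∞ :=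
    ENNReal.mul_ne_top (isCompact_cube n r 0).measure_lt_top.ne <|
      ENNReal.add_ne_top.2 ⟨ENNReal.one_ne_top, ENNReal.mul_ne_top ENNReal.ofReal_ne_top
        (ENNReal.rpow_ne_top_of_nonneg hs.le ENNReal.ofReal_ne_top)⟩
  have hlog : Measurable fun z => Real.log (w z) := hwm.log
  have hball : ∀ z, ∫⁻ x in ball z (r / 2), ENNReal.ofReal |Real.log (w x) - c z| ≤ K :=
    fun z => (lintegral_mono_set (ball_subset_cube n r z)).trans (hc z)
  have hloc : LocallyIntegrable (fun z => Real.log (w z)) volume := fun z => by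
    refine ⟨ball z (r / 2), ball_mem_nhds z (half_pos hr), ?_⟩
    have h : IntegrableOn (fun x => Real.log (w x) - c z) (ball z (r / 2)) volume := by
      refine ⟨(hlog.sub_const _).aestronglyMeasurable, ?_⟩
      rw [hasFiniteIntegral_iff_norm]
      exact (hball z).trans_lt hK.lt_top
    have h' := h.add (integrableOn_const (C := c z) measure_ball_lt_top.ne)
    refine h'.congr (.of_forall fun x => ?_)
    simp
  have hreal : ∀ z, ∫ x in ball z (r / 2), |Real.log (w x) - c z| ≤ K.toReal := fun z => by
    rw [integral_eq_lintegral_of_nonneg_ae (.of_forall fun _ => abs_nonneg _)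
      (hlog.sub_const _).abs.aestronglyMeasurable]
    exact ENNReal.toReal_mono hK (hball z)
  obtain ⟨M, hM⟩ := exists_forall_setIntegral_abs_sub_le (half_pos hr) hloc hreal 1
  have hM0 : 0 ≤ M := (integral_nonneg fun _ => abs_nonneg _).trans (hM 0)
  refine ⟨hloc, (volume.real (ball (0 : En n) 1))⁻¹ * (2 * M) + 1, by positivity, fun z => ?_⟩
  have h := mul_le_mul_of_nonneg_left
    (setIntegral_abs_sub_average_le one_pos hloc (hM z))
    (inv_nonneg.2 (measureReal_nonneg (μ := volume) (s := ball z 1)))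
  rw [← addHaar_real_ball_eq_zero_center z]
  exact h.trans (le_add_of_nonneg_right zero_le_one)

end
end
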